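/- Let ≺ be any admissible order on FreeMonoid σ and let T be a set of words. Then the ideal generated by tip(⟨T⟩) equals ⟨T⟩; in particular, T is a Gröbner basis of the two-sided ideal ⟨T⟩ it generates, with respect to any admissible order. -/

import Mathlib

open scoped TensorProduct

noncomputable section

/-- The embedding of words into the free algebra, sending a word to the product of the
corresponding generators. -/
def wordEmb (K : Type*) [Field K] (σ : Type*) : FreeMonoid σ →* FreeAlgebra K σ :=
  FreeMonoid.lift (FreeAlgebra.ι K)

/-- The coefficient function of an element of the free algebra with respect to the word basis. -/
def coeffw (K : Type*) [Field K] (σ : Type*) (x : FreeAlgebra K σ) : FreeMonoid σ →₀ K :=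
  (FreeAlgebra.basisFreeMonoid K σ).repr x

/-- A `K`-submodule of the free algebra is a two-sided ideal if it is closed under
left and right multiplication by arbitrary elements. -/
def IsIdeal2 (K : Type*) [Field K] (σ : Type*) (I : Submodule K (FreeAlgebra K σ)) : Prop :=
  ∀ a b : FreeAlgebra K σ, ∀ x ∈ I, a * x * b ∈ I

/-- The two-sided ideal generated by a set `S`. -/
def idealGen (K : Type*) [Field K] (σ : Type*) (S : Set (FreeAlgebra K σ)) :
    Submodule K (FreeAlgebra K σ) :=
  Submodule.span K {x | ∃ a s b, s ∈ S ∧ x = a * s * b}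

/-- `lt` is an admissible order on `FreeMonoid σ`: a well-order compatible with
multiplication on both sides, and such that a word is ≤ any word containing it as a factor. -/
structure IsAdmissibleOrder {σ : Type*} (lt : FreeMonoid σ → FreeMonoid σ → Prop) : Prop where
  isWellOrder : IsWellOrder (FreeMonoid σ) lt
  mul_right : ∀ p q r : FreeMonoid σ, lt p q → lt (p * r) (q * r)
  mul_left : ∀ p q s : FreeMonoid σ, lt p q → lt (s * p) (s * q)
  le_mul : ∀ q r s : FreeMonoid σ, q = r * q * s ∨ lt q (r * q * s)

/-- A length admissible order is an admissible order in which longer words are larger. -/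
structure IsLengthAdmissibleOrder {σ : Type*} (lt : FreeMonoid σ → FreeMonoid σ → Prop)
    extends IsAdmissibleOrder lt : Prop where
  length_lt : ∀ p q : FreeMonoid σ, p.length < q.length → lt p q

/-- `t` is the tip (the largest word of the support with respect to `lt`) of `x`. -/
def IsTipOf (K : Type*) [Field K] {σ : Type*} (lt : FreeMonoid σ → FreeMonoid σ → Prop)
    (t : FreeMonoid σ) (x : FreeAlgebra K σ) : Prop :=
  coeffw K σ x t ≠ 0 ∧ ∀ u, coeffw K σ x u ≠ 0 → u = t ∨ lt u t

/-- The set of tips of the nonzero elements of `S`. -/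
def tipSet (K : Type*) [Field K] {σ : Type*} (lt : FreeMonoid σ → FreeMonoid σ → Prop)
    (S : Set (FreeAlgebra K σ)) : Set (FreeMonoid σ) :=
  {t | ∃ x ∈ S, IsTipOf K lt t x}

/-- The set of nontips of `S`: words which are not a tip of an element of `S`. -/
def nontipSet (K : Type*) [Field K] {σ : Type*} (lt : FreeMonoid σ → FreeMonoid σ → Prop)
    (S : Set (FreeAlgebra K σ)) : Set (FreeMonoid σ) :=
  {w | w ∉ tipSet K lt S}

/-- `G` is a Gröbner basis of the two-sided ideal `I` with respect to `lt`. -/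
def IsGrobnerBasis (K : Type*) [Field K] {σ : Type*}
    (lt : FreeMonoid σ → FreeMonoid σ → Prop) (G : Set (FreeAlgebra K σ))
    (I : Submodule K (FreeAlgebra K σ)) : Prop :=
  G ⊆ ↑I ∧ idealGen K σ (wordEmb K σ '' tipSet K lt G) = idealGen K σ (wordEmb K σ '' tipSet K lt ↑I)

/-- `x` is homogeneous of degree `d`: every word in its support has length `d`. -/
def IsHomogOfDeg (K : Type*) [Field K] {σ : Type*} (x : FreeAlgebra K σ) (d : ℕ) : Prop :=
  ∀ w : FreeMonoid σ, coeffw K σ x w ≠ 0 → w.length = d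


theorem aux_basis (K : Type*) [Field K] (σ : Type*) (w : FreeMonoid σ) :
    FreeAlgebra.basisFreeMonoid K σ w = wordEmb K σ w := by
  simp [FreeAlgebra.basisFreeMonoid, wordEmb, FreeAlgebra.equivMonoidAlgebraFreeMonoid]

theorem aux_coeffw (K : Type*) [Field K] (σ : Type*) (w : FreeMonoid σ) :
    coeffw K σ (wordEmb K σ w) = Finsupp.single w 1 := by
  rw [coeffw, ← aux_basis, Module.Basis.repr_self]

theorem aux_tip (K : Type*) [Field K] {σ : Type*} (lt : FreeMonoid σ → FreeMonoid σ → Prop)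
    (t w : FreeMonoid σ) : IsTipOf K lt t (wordEmb K σ w) ↔ t = w := by
  classical
  unfold IsTipOf
  rw [aux_coeffw]
  constructor
  · rintro ⟨h, -⟩
    by_contra hne
    exact h (Finsupp.single_eq_of_ne hne)
  · rintro rfl
    refine ⟨by simp, fun u hu => Or.inl ?_⟩
    by_contra hne
    exact hu (Finsupp.single_eq_of_ne hne)

theorem aux_ideal (K : Type*) [Field K] (σ : Type*) (S : Set (FreeAlgebra K σ))
    (a b x : FreeAlgebra K σ) (hx : x ∈ idealGen K σ S) : a * x * b ∈ idealGen K σ S := by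
  unfold idealGen at hx ⊢
  induction hx using Submodule.span_induction with
  | mem x h =>
    obtain ⟨c, s, d, hs, rfl⟩ := h
    exact Submodule.subset_span ⟨a * c, s, d * b, hs, by simp only [mul_assoc]⟩
  | zero => simp
  | add x y _ _ hx hy => rw [mul_add, add_mul]; exact add_mem hx hy
  | smul c x _ hx =>
    rw [mul_smul_comm, smul_mul_assoc]; exact Submodule.smul_mem _ _ hx

theorem aux_subset (K : Type*) [Field K] (σ : Type*) (S : Set (FreeAlgebra K σ)) :
    S ⊆ idealGen K σ S :=
  fun s hs => Submodule.subset_span ⟨1, s, 1, hs, by simp⟩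

theorem aux_le (K : Type*) [Field K] (σ : Type*) (S S' : Set (FreeAlgebra K σ))
    (h : S ⊆ idealGen K σ S') : idealGen K σ S ≤ idealGen K σ S' := by
  refine Submodule.span_le.2 ?_
  rintro _ ⟨a, s, b, hs, rfl⟩
  exact aux_ideal K σ S' a b s (h hs)

theorem aux_span (K : Type*) [Field K] (σ : Type*) (T : Set (FreeMonoid σ)) :
    idealGen K σ (wordEmb K σ '' T) ≤ Submodule.span K
      (FreeAlgebra.basisFreeMonoid K σ '' {w | ∃ p, ∃ t ∈ T, ∃ q, w = p * t * q}) := by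
  refine Submodule.span_le.2 ?_
  rintro _ ⟨a, _, b, ⟨t, ht, rfl⟩, rfl⟩
  have ha := (FreeAlgebra.basisFreeMonoid K σ).mem_span a
  have hb := (FreeAlgebra.basisFreeMonoid K σ).mem_span b
  have key : a * wordEmb K σ t * b ∈
      Submodule.span K (Set.range (FreeAlgebra.basisFreeMonoid K σ)) *
      Submodule.span K {wordEmb K σ t} *
      Submodule.span K (Set.range (FreeAlgebra.basisFreeMonoid K σ)) :=
    Submodule.mul_mem_mul (Submodule.mul_mem_mul ha (Submodule.mem_span_singleton_self _)) hb
  rw [Submodule.span_mul_span, Submodule.span_mul_span] at key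
  refine Submodule.span_mono ?_ key
  rintro _ ⟨_, ⟨_, ⟨p, rfl⟩, _, rfl, rfl⟩, _, ⟨q, rfl⟩, rfl⟩
  exact ⟨p * t * q, ⟨p, t, ht, q, rfl⟩, by simp only [aux_basis, map_mul]⟩

theorem aux_supp (K : Type*) [Field K] (σ : Type*) (T : Set (FreeMonoid σ))
    (x : FreeAlgebra K σ) (hx : x ∈ idealGen K σ (wordEmb K σ '' T)) (w : FreeMonoid σ)
    (hw : coeffw K σ x w ≠ 0) : wordEmb K σ w ∈ idealGen K σ (wordEmb K σ '' T) := by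
  have h := ((FreeAlgebra.basisFreeMonoid K σ).mem_span_image).1 (aux_span K σ T hx)
  obtain ⟨p, t, ht, q, rfl⟩ := h (Finsupp.mem_support_iff.2 hw)
  exact Submodule.subset_span ⟨_, _, _, ⟨t, ht, rfl⟩, by simp only [map_mul]; rfl⟩

/-- `⟨tip⟨T⟩⟩ = ⟨T⟩`, so a set of words is a Gröbner basis of the ideal it
generates, for any admissible order. -/
theorem stmt8 (K : Type*) [Field K] (σ : Type*)
    (lt : FreeMonoid σ → FreeMonoid σ → Prop) (hlt : IsAdmissibleOrder lt)
    (T : Set (FreeMonoid σ)) :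
    idealGen K σ (wordEmb K σ ''
        tipSet K lt ((idealGen K σ (wordEmb K σ '' T) : Set (FreeAlgebra K σ))))
      = idealGen K σ (wordEmb K σ '' T) ∧
    IsGrobnerBasis K lt (wordEmb K σ '' T) (idealGen K σ (wordEmb K σ '' T)) := by
  have h1 : idealGen K σ (wordEmb K σ ''
        tipSet K lt ((idealGen K σ (wordEmb K σ '' T) : Set (FreeAlgebra K σ))))
      = idealGen K σ (wordEmb K σ '' T) := by
    apply le_antisymm
    · apply aux_le
      rintro _ ⟨t, ⟨x, hx, ht, -⟩, rfl⟩
      exact aux_supp K σ T x hx t ht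
    · apply aux_le
      rintro _ ⟨t, ht, rfl⟩
      exact aux_subset K σ _ ⟨t, ⟨_, aux_subset K σ _ ⟨t, ht, rfl⟩, (aux_tip K lt t t).2 rfl⟩, rfl⟩
  refine ⟨h1, aux_subset K σ _, ?_⟩
  rw [h1]
  congr 2
  ext t
  constructor
  · rintro ⟨_, ⟨w, hw, rfl⟩, h⟩
    rwa [(aux_tip K lt t w).1 h]
  · exact fun ht => ⟨_, ⟨t, ht, rfl⟩, (aux_tip K lt t t).2 rfl⟩
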